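/- For every integer m ≥ 1 one has \overline{t^{−m} u\, dt} = Σ_{k=1}^{r} Q_{m,−k}\, ω_k in Ω_R/dR. -/

import Mathlib

open scoped BigOperators

noncomputable section

/-- The hyperelliptic ring `R = ℂ[t,t⁻¹,u : u² = p(t)]`, realized as
`ℂ[t,t⁻¹][X]/(X² - p)`. -/
abbrev HypRing (p : LaurentPolynomial ℂ) : Type :=
  AdjoinRoot (Polynomial.X ^ 2 - Polynomial.C p)

/-- The element `t^i` of `R`, for `i : ℤ`. -/
noncomputable def tP (p : LaurentPolynomial ℂ) (i : ℤ) : HypRing p :=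
  AdjoinRoot.of _ (LaurentPolynomial.T i)

/-- The element `u` of `R`. -/
noncomputable def uE (p : LaurentPolynomial ℂ) : HypRing p := AdjoinRoot.root _

/-- The module of Kähler differentials `Ω_R` of `R` over `ℂ`. -/
abbrev HypOmega (p : LaurentPolynomial ℂ) := KaehlerDifferential ℂ (HypRing p)

/-- The subspace `dR ⊆ Ω_R` of exact differentials. -/
noncomputable def dSub (p : LaurentPolynomial ℂ) : Submodule ℂ (HypOmega p) :=
  LinearMap.range (KaehlerDifferential.D ℂ (HypRing p)).toLinearMap

/-- The quotient `Ω_R/dR`. -/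
abbrev HypCenter (p : LaurentPolynomial ℂ) := HypOmega p ⧸ dSub p

/-- The class `\overline{f dg}` of `f dg` in `Ω_R/dR`. -/
noncomputable def cls (p : LaurentPolynomial ℂ) (f g : HypRing p) : HypCenter p :=
  Submodule.Quotient.mk (f • (KaehlerDifferential.D ℂ (HypRing p) g))

/-- `ω₀ = \overline{t⁻¹ dt}` and `ω_k = \overline{t^{-k} u dt}` for `k ≥ 1`. -/
noncomputable def om (p : LaurentPolynomial ℂ) (k : ℕ) : HypCenter p :=
  if k = 0 then cls p (tP p (-1)) (tP p 1)
  else cls p (tP p (-(k : ℤ)) * uE p) (tP p 1)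
/-- Power rule for integer powers of a unit. -/
theorem Derivation.map_units_zpow {K A M : Type*} [CommRing K] [CommRing A] [Algebra K A]
    [AddCommGroup M] [Module A M] [Module K M]
    (D : Derivation K A M) (t : Aˣ) (n : ℤ) :
    D ((t ^ n : Aˣ) : A) = n • ((t ^ (n - 1) : Aˣ) : A) • D (t : A) := by
  have step (i : ℤ) : D ((t ^ (i + 1) : Aˣ) : A)
      = ((t ^ i : Aˣ) : A) • D (t : A) + (t : A) • D ((t ^ i : Aˣ) : A) := by
    rw [zpow_add_one, Units.val_mul, D.leibniz]
  have shift (i : ℤ) : (t : A) * ((t ^ (i - 1) : Aˣ) : A) = ((t ^ i : Aˣ) : A) := by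
    rw [← Units.val_mul, ← zpow_one_add, add_sub_cancel]
  induction n using Int.induction_on with
  | zero => simp
  | succ i ih =>
    rw [step, ih, smul_comm (t : A) (i : ℤ), smul_smul, shift, add_sub_cancel_right, add_smul,
      one_smul, add_comm]
  | pred i ih =>
    have h := step (-(i : ℤ) - 1)
    rw [sub_add_cancel, ih] at h
    have cancel : (t : A) • D ((t ^ (-(i : ℤ) - 1) : Aˣ) : A)
        = (t : A) • ((-(i : ℤ) - 1) • ((t ^ (-(i : ℤ) - 1 - 1) : Aˣ) : A) • D (t : A)) := by
      rw [smul_comm (t : A) (-(i : ℤ) - 1), smul_smul, shift, sub_smul, h, one_smul]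
      abel
    simpa [smul_smul] using congrArg (fun x => ((t⁻¹ : Aˣ) : A) • x) cancel

/-- If `u² = ∑ aⱼ tʲ`, then `2 d(tⁿ u³) = ∑ (2n + 3j) aⱼ tⁿ⁺ʲ⁻¹ u dt`. -/
theorem Derivation.two_smul_map_zpow_mul_cube {K A M : Type*} [CommRing K] [CommRing A]
    [Algebra K A] [AddCommGroup M] [Module A M] [Module K M] [IsScalarTower K A M]
    (D : Derivation K A M) (t : Aˣ) (u : A) (s : Finset ℕ) (a : ℕ → K)
    (hu : u ^ 2 = ∑ j ∈ s, a j • ((t ^ (j : ℤ) : Aˣ) : A)) (n : ℤ) :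
    (2 : K) • D (((t ^ n : Aˣ) : A) * u ^ 3)
      = ∑ j ∈ s, (((2 * n + 3 * (j : ℤ) : ℤ) : K) * a j) •
          (((t ^ (n + j - 1) : Aˣ) : A) * u) • D (t : A) := by
  have hDu : (2 : A) • u • D u
      = (∑ j ∈ s, ((j : A) * algebraMap K A (a j)) * ((t ^ ((j : ℤ) - 1) : Aˣ) : A)) •
          D (t : A) := by
    have h := congrArg D hu
    rw [D.leibniz_pow] at h
    simp only [map_sum, D.map_smul, D.map_units_zpow] at h
    rw [Finset.sum_smul]
    convert h using 1
    · simp [two_smul]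
    · refine Finset.sum_congr rfl fun j _ => ?_
      rw [← algebraMap_smul A (a j), ← Int.cast_smul_eq_zsmul A, smul_smul, smul_smul]
      congr 1
      push_cast
      ring
  have hcube : D (u ^ 3) = ((3 : A) * u) • u • D u := by
    rw [D.leibniz_pow, ← Nat.cast_smul_eq_nsmul A, smul_smul, smul_smul]
    congr 1
    push_cast
    ring
  have hzp (i k : ℤ) : ((t ^ (i + k) : Aˣ) : A) = ((t ^ i : Aˣ) : A) * ((t ^ k : Aˣ) : A) := by
    rw [zpow_add, Units.val_mul]
  calc (2 : K) • D (((t ^ n : Aˣ) : A) * u ^ 3)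
      = (((t ^ n : Aˣ) : A) * (3 * u)) • ((2 : A) • u • D u)
        + (2 * u ^ 3 * n * ((t ^ (n - 1) : Aˣ) : A)) • D (t : A) := by
        rw [D.leibniz, hcube, D.map_units_zpow, ← algebraMap_smul A (2 : K),
          ← Int.cast_smul_eq_zsmul A, map_ofNat]
        module
    _ = _ := by
        rw [hDu, smul_smul, ← add_smul, pow_succ u 2, hu, Finset.mul_sum, Finset.sum_mul,
          Finset.mul_sum, Finset.sum_mul, Finset.sum_mul, ← Finset.sum_add_distrib,
          Finset.sum_smul]
        refine Finset.sum_congr rfl fun j _ => ?_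
        rw [← algebraMap_smul A (_ * a j), smul_smul, Algebra.smul_def]
        congr 1
        have h1 : ((t ^ (n + j - 1) : Aˣ) : A)
            = ((t ^ n : Aˣ) : A) * ((t ^ ((j : ℤ) - 1) : Aˣ) : A) := by
          rw [← hzp, add_sub_assoc]
        have h2 : ((t ^ (n + j - 1) : Aˣ) : A)
            = ((t ^ (n - 1) : Aˣ) : A) * ((t ^ (j : ℤ) : Aˣ) : A) := by
          rw [← hzp]; congr 2; ring
        have h3 : algebraMap K A ((2 * n + 3 * (j : ℤ) : ℤ) : K) = 2 * n + 3 * j := by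
          rw [_root_.map_intCast (algebraMap K A)]
          push_cast
          ring
        rw [map_mul, h3]
        linear_combination (-(3 * (j : A) * algebraMap K A (a j) * u)) * h1
          - (2 * (n : A) * algebraMap K A (a j) * u) * h2

theorem tP_zero (p : LaurentPolynomial ℂ) : tP p 0 = 1 := by
  rw [tP, LaurentPolynomial.T_zero, map_one]

theorem tP_add (p : LaurentPolynomial ℂ) (i j : ℤ) : tP p (i + j) = tP p i * tP p j := by
  rw [tP, LaurentPolynomial.T_add, map_mul]
  rfl

/-- The unit `t` of the hyperelliptic ring. -/
def tUnit (p : LaurentPolynomial ℂ) : (HypRing p)ˣ where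
  val := tP p 1
  inv := tP p (-1)
  val_inv := by rw [← tP_add, add_neg_cancel, tP_zero]
  inv_val := by rw [← tP_add, neg_add_cancel, tP_zero]

theorem coe_tUnit_zpow (p : LaurentPolynomial ℂ) (n : ℤ) :
    ((tUnit p ^ n : (HypRing p)ˣ) : HypRing p) = tP p n := by
  induction n using Int.induction_on with
  | zero => rw [zpow_zero, Units.val_one, tP_zero]
  | succ i ih => rw [zpow_add_one, Units.val_mul, ih, tP_add]; rfl
  | pred i ih => rw [zpow_sub_one, Units.val_mul, ih]; exact (tP_add p _ _).symm

theorem uE_sq (p : LaurentPolynomial ℂ) : uE p ^ 2 = AdjoinRoot.of _ p := by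
  have h := AdjoinRoot.eval₂_root (Polynomial.X ^ 2 - Polynomial.C p)
  rw [Polynomial.eval₂_sub, Polynomial.eval₂_X_pow, Polynomial.eval₂_C, sub_eq_zero] at h
  exact h

theorem of_C_mul_T (p : LaurentPolynomial ℂ) (c : ℂ) (n : ℤ) :
    AdjoinRoot.of (Polynomial.X ^ 2 - Polynomial.C p)
      (LaurentPolynomial.C c * LaurentPolynomial.T n) = c • tP p n := by
  rw [map_mul, Algebra.smul_def]
  rfl

/-- The relation among the classes `t⁻ᵏ u dt` obtained from `d(t⁻ᵐ u³)`. -/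
theorem sum_smul_cls_eq_zero (p : LaurentPolynomial ℂ) (s : Finset ℕ) (a : ℕ → ℂ)
    (hpa : p = ∑ j ∈ s, LaurentPolynomial.C (a j) * LaurentPolynomial.T (j : ℤ)) (m : ℤ) :
    ∑ j ∈ s, (((3 * (j : ℤ) - 2 * m : ℤ) : ℂ) * a j) •
      cls p (tP p (-(m - j + 1)) * uE p) (tP p 1) = 0 := by
  have hu : uE p ^ 2 = ∑ j ∈ s, a j • ((tUnit p ^ (j : ℤ) : (HypRing p)ˣ) : HypRing p) := by
    simp only [coe_tUnit_zpow, ← of_C_mul_T]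
    rw [uE_sq, ← map_sum, ← hpa]
  have h := (KaehlerDifferential.D ℂ (HypRing p)).two_smul_map_zpow_mul_cube
    (tUnit p) (uE p) s a hu (-m)
  have hmem : ∑ j ∈ s, (((3 * (j : ℤ) - 2 * m : ℤ) : ℂ) * a j) •
      ((tP p (-(m - j + 1)) * uE p) • KaehlerDifferential.D ℂ (HypRing p) (tP p 1))
        ∈ dSub p := by
    refine (congrArg (· ∈ dSub p) ?_).mp
      ((dSub p).smul_mem (2 : ℂ) (LinearMap.mem_range_self _
        (((tUnit p ^ (-m) : (HypRing p)ˣ) : HypRing p) * uE p ^ 3)))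
    refine h.trans (Finset.sum_congr rfl fun j _ => ?_)
    rw [coe_tUnit_zpow, show -m + (j : ℤ) - 1 = -(m - j + 1) by ring,
      show 2 * -m + 3 * (j : ℤ) = 3 * j - 2 * m by ring]
    rfl
  have h0 := (Submodule.Quotient.mk_eq_zero (dSub p)).mpr hmem
  rw [← Submodule.mkQ_apply, map_sum] at h0
  refine (Finset.sum_congr rfl fun j _ => ?_).trans h0
  rw [map_smul]
  rfl

theorem linearCoeff_ne_zero (r : ℕ) (α : Fin r → ℂ) (hα0 : ∀ i, α i ≠ 0) (a : ℕ → ℂ)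
    (h : LaurentPolynomial.T 1 *
        ∏ i : Fin r, (LaurentPolynomial.T 1 - LaurentPolynomial.C (α i))
      = ∑ i ∈ Finset.Icc 1 (r + 1), LaurentPolynomial.C (a i) * LaurentPolynomial.T (i : ℤ)) :
    a 1 ≠ 0 := by
  have hpoly : (Polynomial.X * ∏ i : Fin r, (Polynomial.X - Polynomial.C (α i)) :
      Polynomial ℂ) = ∑ i ∈ Finset.Icc 1 (r + 1), Polynomial.C (a i) * Polynomial.X ^ i := by
    apply Polynomial.toLaurent_injective
    simpa [map_prod] using h
  have hcoeff := congrArg (Polynomial.coeff · 1) hpoly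
  simp only [Polynomial.coeff_X_mul, Polynomial.finsetSum_coeff,
    Polynomial.coeff_C_mul_X_pow] at hcoeff
  rw [Finset.sum_ite_eq, if_pos (by simp), Polynomial.coeff_zero_eq_eval_zero,
    Polynomial.eval_prod] at hcoeff
  rw [← hcoeff, Finset.prod_ne_zero_iff]
  intro i _
  simpa using hα0 i

/-- A sequence of vectors satisfying the recursion that defines the coefficients `Q` is the
corresponding combination of its first `r` terms. -/
theorem eq_sum_smul_of_recursion {K V : Type*} [Field K] [CharZero K] [AddCommGroup V]
    [Module K V] (r : ℕ) (a : ℕ → K) (ha1 : a 1 ≠ 0) (Q : ℤ → ℤ → K)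
    (hQinit : ∀ m i : ℤ, 1 ≤ m → m ≤ (r : ℤ) → -(r : ℤ) ≤ i → i ≤ -1 →
      Q m i = if m = -i then 1 else 0)
    (hQrec : ∀ m : ℤ, (r : ℤ) + 1 ≤ m → ∀ i : ℤ,
      ((2 * m - 3 : ℤ) : K) * a 1 * Q m i
        = ∑ j ∈ Finset.Icc 2 (r + 1),
            ((3 * (j : ℤ) - 2 * m : ℤ) : K) * a j * Q (m - j + 1) i)
    (x : ℤ → V)
    (hx : ∀ m : ℤ, (r : ℤ) + 1 ≤ m →
      ∑ j ∈ Finset.Icc 1 (r + 1),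
        (((3 * (j : ℤ) - 2 * m : ℤ) : K) * a j) • x (m - j + 1) = 0) (m : ℤ) :
    1 ≤ m → x m = ∑ k ∈ Finset.Icc 1 r, Q m (-(k : ℤ)) • x k := by
  induction m using Int.strongRec (m := 1) with
  | lt m hm => intro h; omega
  | ge m _ ih =>
    intro hm
    rcases le_or_gt m r with hmr | hmr
    · lift m to ℕ using by omega
      rw [Finset.sum_eq_single m]
      · rw [hQinit _ _ hm hmr (by omega) (by omega), if_pos (by ring), one_smul]
      · intro k hk hkm
        rw [Finset.mem_Icc] at hk
        rw [hQinit _ _ hm hmr (by omega) (by omega), if_neg (by omega), zero_smul]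
      · intro hk
        rw [Finset.mem_Icc] at hk
        omega
    · have hcoef : ((2 * m - 3 : ℤ) : K) * a 1 ≠ 0 :=
        mul_ne_zero (Int.cast_ne_zero.mpr (by omega)) ha1
      have hrel := hx m (by omega)
      rw [← Finset.add_sum_Ioc_eq_sum_Icc (by omega : 1 ≤ r + 1),
        show Finset.Ioc 1 (r + 1) = Finset.Icc 2 (r + 1) from rfl] at hrel
      refine smul_right_injective _ hcoef ?_
      calc (((2 * m - 3 : ℤ) : K) * a 1) • x m
          = ∑ j ∈ Finset.Icc 2 (r + 1), (((3 * (j : ℤ) - 2 * m : ℤ) : K) * a j) •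
              x (m - j + 1) := by
            rw [← neg_eq_of_add_eq_zero_right hrel, ← neg_smul]
            congr 1
            · push_cast; ring
            · congr 1; push_cast; ring
        _ = ∑ j ∈ Finset.Icc 2 (r + 1), (((3 * (j : ℤ) - 2 * m : ℤ) : K) * a j) •
              ∑ k ∈ Finset.Icc 1 r, Q (m - j + 1) (-(k : ℤ)) • x k := by
            refine Finset.sum_congr rfl fun j hj => ?_
            rw [Finset.mem_Icc] at hj
            rw [ih (m - j + 1) (by omega) (by omega)]
        _ = (((2 * m - 3 : ℤ) : K) * a 1) •
              ∑ k ∈ Finset.Icc 1 r, Q m (-(k : ℤ)) • x k := by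
            simp only [Finset.smul_sum, smul_smul]
            rw [Finset.sum_comm]
            refine Finset.sum_congr rfl fun k _ => ?_
            rw [← Finset.sum_smul, hQrec m (by omega)]

/-- For every integer `m ≥ 1` one has `\overline{t^{−m} u dt} = Σ_{k=1}^{r} Q_{m,−k} ω_k`
in `Ω_R/dR`. -/
theorem tnegpow_u_dt_eq_Q_sum (r : ℕ) (hr : 1 ≤ r)
    (α : Fin r → ℂ) (hα0 : ∀ i, α i ≠ 0) (hαinj : Function.Injective α)
    (a : ℕ → ℂ) (p : LaurentPolynomial ℂ)
    (hp : p = LaurentPolynomial.T 1 *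
      ∏ i : Fin r, (LaurentPolynomial.T 1 - LaurentPolynomial.C (α i)))
    (hpa : p = ∑ i ∈ Finset.Icc 1 (r + 1),
      LaurentPolynomial.C (a i) * LaurentPolynomial.T (i : ℤ))
    (Q : ℤ → ℤ → ℂ)
    (hQinit : ∀ m i : ℤ, 1 ≤ m → m ≤ (r : ℤ) → -(r : ℤ) ≤ i → i ≤ -1 →
      Q m i = if m = -i then 1 else 0)
    (hQrec : ∀ m : ℤ, (r : ℤ) + 1 ≤ m → ∀ i : ℤ,
      ((2 * m - 3 : ℤ) : ℂ) * a 1 * Q m i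
        = ∑ j ∈ Finset.Icc 2 (r + 1),
            ((3 * (j : ℤ) - 2 * m : ℤ) : ℂ) * a j * Q (m - j + 1) i) :
    ∀ m : ℤ, 1 ≤ m →
      cls p (tP p (-m) * uE p) (tP p 1)
        = ∑ k ∈ Finset.Icc 1 r, Q m (-(k : ℤ)) • om p k := by
  have ha1 : a 1 ≠ 0 := linearCoeff_ne_zero r α hα0 a (hp.symm.trans hpa)
  intro m hm
  have hsum := eq_sum_smul_of_recursion r a ha1 Q hQinit hQrec
    (fun n => cls p (tP p (-n) * uE p) (tP p 1))
    (fun n _ => sum_smul_cls_eq_zero p _ a hpa n) m hm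
  refine hsum.trans (Finset.sum_congr rfl fun k hk => ?_)
  rw [om, if_neg (by rw [Finset.mem_Icc] at hk; omega)]

end
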